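/- arXiv:1210.6964 — 6 statements merged into one kernel-verified Lean document; each statement's English description precedes it below -/
import Mathlib

section
/- Let H be a Hopf algebra over a field k equipped with an R-matrix R, monodromy matrix Q = R₂₁·R, and a ribbon element v, and let λ ∈ H* be a right cointegral. Then f_{Q⁻¹}(λ ∘ L_v) = λ(v)·v⁻¹, where L_v : H → H denotes left multiplication by v; explicitly, ((x ↦ λ(v·x)) ⊗ id)(Q⁻¹) = λ(v)·v⁻¹ in H. -/
open scoped TensorProduct

/-- `(φ ⊗ id)` applied to an element of `H ⊗ H`, i.e. `φ ⊗ₜ id` followed by scalar action. -/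
noncomputable def pairLeft (k H : Type) [Field k] [Ring H] [Algebra k H]
    (φ : H →ₗ[k] k) : H ⊗[k] H →ₗ[k] H :=
  TensorProduct.lift ((LinearMap.lsmul k H).comp φ)

theorem pairLeft_tmul_mul (k H : Type) [Field k] [Ring H] [Algebra k H]
    (φ : H →ₗ[k] k) (a b : H) (X : H ⊗[k] H) :
    pairLeft k H φ ((a ⊗ₜ[k] b) * X) = b * pairLeft k H (φ ∘ₗ LinearMap.mulLeft k a) X := by
  induction X with
  | zero => simp
  | tmul x y => simp [pairLeft]
  | add x y hx hy => simp only [mul_add, map_add, hx, hy]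

/-- For a Hopf algebra `H` over a field `k` with R-matrix `Rm` (inverse `Rm'`),
monodromy matrix `Q = R₂₁·R` (inverse `Qinv`), ribbon element `v` (inverse `v'`) and a right
cointegral `lam`, one has `f_{Q⁻¹}(lam ∘ L_v) = lam(v) • v⁻¹`. -/
theorem drinfeld_inverse_of_ribbon_cointegral
    (k H : Type) [Field k] [Ring H] [HopfAlgebra k H]
    (Rm Rm' : H ⊗[k] H) (hinv₁ : Rm * Rm' = 1) (hinv₂ : Rm' * Rm = 1)
    (hconj : ∀ h : H, Rm * Coalgebra.comul (R := k) h * Rm' =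
      TensorProduct.comm k H H (Coalgebra.comul (R := k) h))
    (Qinv : H ⊗[k] H)
    (hQ₁ : (TensorProduct.comm k H H Rm * Rm) * Qinv = 1)
    (hQ₂ : Qinv * (TensorProduct.comm k H H Rm * Rm) = 1)
    (v v' : H) (hv₁ : v * v' = 1) (hv₂ : v' * v = 1)
    (hvcentral : ∀ h : H, v * h = h * v)
    (hvcounit : Coalgebra.counit (R := k) v = 1)
    (hvantipode : HopfAlgebra.antipode (R := k) v = v)
    (hvcomul : Coalgebra.comul (R := k) v = (v ⊗ₜ[k] v) * Qinv)
    (lam : H →ₗ[k] k)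
    (hlam : ∀ h : H, pairLeft k H lam (Coalgebra.comul (R := k) h) = lam h • (1 : H)) :
    pairLeft k H (lam ∘ₗ LinearMap.mulLeft k v) Qinv = lam v • v' := by
  have hv := hlam v
  rw [hvcomul, pairLeft_tmul_mul] at hv
  simpa [← mul_assoc, hv₂] using congrArg (v' * ·) hv
end

section
/- Let H be a Hopf algebra over a field k, Λ ∈ H a left integral, and λ ∈ H* a right cointegral. Then for every a ∈ H one has Σ λ(S(a)·Λ₍₁₎)·Λ₍₂₎ = λ(Λ)·a. (This is the identity expressing that the inverse of the Frobenius map Ψ : a ↦ λ(S(a)·–) is given, up to the factor λ(Λ), by φ ↦ (φ⊗id)(Δ(Λ)).) -/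
open scoped TensorProduct

/-- In a Hopf algebra, `Σ (S(a₍₁₎) ⊗ 1) * Δ(a₍₂₎) = 1 ⊗ a`. -/
theorem HopfAlgebra.sum_antipode_tmul_one_mul_comul {R A ι : Type*} [CommSemiring R] [Semiring A]
    [HopfAlgebra R A] {a : A} (r : Coalgebra.Repr R a ι) :
    ∑ i ∈ r.index, (HopfAlgebra.antipode R (r.left i) ⊗ₜ[R] (1 : A)) *
      Coalgebra.comul (R := R) (r.right i) = 1 ⊗ₜ[R] a := by
  let F : A ⊗[R] (A ⊗[R] A) →ₗ[R] A ⊗[R] A :=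
    (LinearMap.mul' R A ∘ₗ (HopfAlgebra.antipode R).rTensor A).rTensor A ∘ₗ
      (TensorProduct.assoc R A A A).symm.toLinearMap
  have hF (x : A) (t : A ⊗[R] A) :
      F (x ⊗ₜ t) = (HopfAlgebra.antipode R x ⊗ₜ[R] (1 : A)) * t := by
    induction t with
    | zero => simp
    | add s t hs ht => rw [TensorProduct.tmul_add, map_add, hs, ht, mul_add]
    | tmul y z => simp [F]
  have h := congrArg F (Coalgebra.coassoc_apply (R := R) a).symm
  have hl : F (Coalgebra.comul.lTensor A (Coalgebra.comul (R := R) a)) =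
      ∑ i ∈ r.index, (HopfAlgebra.antipode R (r.left i) ⊗ₜ[R] (1 : A)) *
        Coalgebra.comul (R := R) (r.right i) := by
    conv_lhs => rw [← r.eq]
    simp [hF]
  rw [← hl, h]
  simp only [F, LinearMap.comp_apply, LinearEquiv.coe_coe, LinearEquiv.symm_apply_apply]
  rw [← LinearMap.rTensor_comp_apply, LinearMap.comp_assoc, HopfAlgebra.mul_antipode_rTensor_comul,
    LinearMap.rTensor_comp_apply, Coalgebra.rTensor_counit_comul]
  simp

/-- For a left integral `Λ`, `(S(a) ⊗ 1) * Δ(Λ) = (1 ⊗ a) * Δ(Λ)`. -/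
theorem HopfAlgebra.antipode_tmul_one_mul_comul_of_leftIntegral {R A : Type*} [CommSemiring R]
    [Semiring A] [HopfAlgebra R A] {Λ : A}
    (hΛ : ∀ h : A, h * Λ = Coalgebra.counit (R := R) h • Λ) (a : A) :
    (HopfAlgebra.antipode R a ⊗ₜ[R] (1 : A)) * Coalgebra.comul (R := R) Λ =
      ((1 : A) ⊗ₜ[R] a) * Coalgebra.comul (R := R) Λ := by
  let r := Coalgebra.Repr.arbitrary R a
  have hr : ∑ i ∈ r.index, Coalgebra.counit (R := R) (r.right i) • r.left i = a := by
    have h := congrArg (TensorProduct.rid R A) (Coalgebra.sum_tmul_counit_eq r)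
    simpa only [map_sum, TensorProduct.rid_tmul, one_smul] using h
  rw [← HopfAlgebra.sum_antipode_tmul_one_mul_comul r, Finset.sum_mul]
  conv_lhs => rw [← hr]
  simp only [mul_assoc, ← Bialgebra.comul_mul, hΛ, map_sum, map_smul, TensorProduct.sum_tmul,
    Finset.sum_mul, ← TensorProduct.smul_tmul', smul_mul_assoc, mul_smul_comm]

/-- For a Hopf algebra `H` with left integral `Λ` and right cointegral `lam`,
for every `a ∈ H` one has `Σ lam(S(a)·Λ₍₁₎) · Λ₍₂₎ = lam(Λ) • a`. -/
theorem frobenius_map_inverse_identity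
    (k H : Type) [Field k] [Ring H] [HopfAlgebra k H]
    (Λ : H) (hΛ : ∀ h : H, h * Λ = Coalgebra.counit (R := k) h • Λ)
    (lam : H →ₗ[k] k)
    (hlam : ∀ h : H, pairLeft k H lam (Coalgebra.comul (R := k) h) = lam h • (1 : H)) :
    ∀ a : H,
      pairLeft k H (lam ∘ₗ LinearMap.mulLeft k (HopfAlgebra.antipode (R := k) a))
          (Coalgebra.comul (R := k) Λ) = lam Λ • a := by
  intro a
  have mul_left (x : H) (t : H ⊗[k] H) : pairLeft k H (lam ∘ₗ LinearMap.mulLeft k x) t =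
      pairLeft k H lam ((x ⊗ₜ[k] (1 : H)) * t) := by
    induction t with
    | zero => simp
    | add s t hs ht => rw [map_add, hs, ht, mul_add, map_add]
    | tmul y z => simp [pairLeft]
  have mul_right (t : H ⊗[k] H) :
      pairLeft k H lam (((1 : H) ⊗ₜ[k] a) * t) = a * pairLeft k H lam t := by
    induction t with
    | zero => simp
    | add s t hs ht => rw [mul_add, map_add, hs, ht, map_add, mul_add]
    | tmul y z => simp [pairLeft]
  rw [mul_left, HopfAlgebra.antipode_tmul_one_mul_comul_of_leftIntegral hΛ, mul_right, hlam,
    mul_smul_comm, mul_one]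
end

section
/- Let H be a Hopf algebra over a field k and let λ ∈ H* satisfy λ(xy) = λ(S²(y)·x) for all x, y ∈ H. Define the Frobenius map Ψ : H → H* by Ψ(a)(y) = λ(S(a)·y), the left adjoint action of H on itself by h ▷ x = Σ h₍₁₎·x·S(h₍₂₎), and the left coadjoint action of H on H* by (h ⇀ φ)(y) = φ(S(h₍₁₎)·y·h₍₂₎). Then Ψ intertwines the adjoint and coadjoint actions: Ψ(h ▷ x) = h ⇀ Ψ(x) for all h, x ∈ H. -/
open scoped TensorProduct

/-- The left adjoint action `h ▷ x = Σ h₍₁₎ · x · S(h₍₂₎)` of a Hopf algebra on itself. -/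
noncomputable def adAct (k H : Type) [Field k] [Ring H] [HopfAlgebra k H] (h x : H) : H :=
  LinearMap.mul' k H
    (TensorProduct.map (LinearMap.mulRight k x) (HopfAlgebra.antipode (R := k))
      (Coalgebra.comul (R := k) h))

/-- The element `Σ S(h₍₁₎) · y · h₍₂₎`, so that the left coadjoint action is
`(h ⇀ φ)(y) = φ (coadEl h y)`. -/
noncomputable def coadEl (k H : Type) [Field k] [Ring H] [HopfAlgebra k H] (h y : H) : H :=
  LinearMap.mul' k H
    (TensorProduct.map ((LinearMap.mulRight k y) ∘ₗ HopfAlgebra.antipode (R := k)) LinearMap.id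
      (Coalgebra.comul (R := k) h))

/-- The Frobenius map `Ψ(a) = (y ↦ lam (S(a)·y))` intertwines the left adjoint
action of `H` on itself and the left coadjoint action of `H` on `H*`:
`Ψ(h ▷ x) = h ⇀ Ψ(x)`, i.e. pointwise `lam (S(h ▷ x)·y) = lam (S(x) · Σ S(h₍₁₎)·y·h₍₂₎)`. -/
theorem frobenius_map_intertwines_adjoint_coadjoint
    (k H : Type) [Field k] [Ring H] [HopfAlgebra k H]
    (lam : H →ₗ[k] k)
    (hlam : ∀ x y : H,
      lam (x * y) = lam (HopfAlgebra.antipode (R := k) (HopfAlgebra.antipode (R := k) y) * x)) :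
    ∀ h x y : H,
      lam (HopfAlgebra.antipode (R := k) (adAct k H h x) * y) =
        lam (HopfAlgebra.antipode (R := k) x * coadEl k H h y) := by
  intro h x y
  rw [adAct, coadEl, ← (Coalgebra.Repr.arbitrary k h).eq]
  simp only [map_sum, TensorProduct.map_tmul, LinearMap.mul'_apply, LinearMap.mulRight_apply,
    LinearMap.comp_apply, LinearMap.id_apply, Finset.sum_mul, Finset.mul_sum,
    HopfAlgebra.antipode_mul_antidistrib]
  refine Finset.sum_congr rfl fun i _ => ?_
  simpa only [mul_assoc] using
    (hlam (HopfAlgebra.antipode k x *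
      (HopfAlgebra.antipode k ((Coalgebra.Repr.arbitrary k h).left i) * y))
      ((Coalgebra.Repr.arbitrary k h).right i)).symm
end

section
/- Let H be a Hopf algebra over a field k with bijective antipode S, and let λ ∈ H* satisfy λ(xy) = λ(S²(y)·x) for all x, y ∈ H. Define Ψ : H → H* by Ψ(a)(y) = λ(S(a)·y). Then Ψ is a morphism of H-bimodules from the regular bimodule H (with left and right actions given by multiplication) to H* with the coregular actions: Ψ(h·a·h') = h ⇀ Ψ(a) ↼ h' for all h, a, h' ∈ H. -/
/-- The Frobenius map `Ψ(a) = (x ↦ lam (S(a)·x))` is a morphism of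
`H`-bimodules from the regular bimodule `H` to `H*` with the coregular actions:
`Ψ(h·a·h') = h ⇀ Ψ(a) ↼ h'`, i.e. pointwise
`lam (S(h·a·h')·x) = lam (S(a)·(S(h)·x·S⁻¹(h')))`. -/
theorem frobenius_map_bimodule_morphism
    (k H : Type) [Field k] [Ring H] [HopfAlgebra k H]
    (S' : H →ₗ[k] H)
    (hS'₁ : ∀ x : H, HopfAlgebra.antipode (R := k) (S' x) = x)
    (hS'₂ : ∀ x : H, S' (HopfAlgebra.antipode (R := k) x) = x)
    (lam : H →ₗ[k] k)
    (hlam : ∀ x y : H,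
      lam (x * y) = lam (HopfAlgebra.antipode (R := k) (HopfAlgebra.antipode (R := k) y) * x)) :
    ∀ h a h' x : H,
      lam (HopfAlgebra.antipode (R := k) (h * a * h') * x) =
        lam (HopfAlgebra.antipode (R := k) a *
          (HopfAlgebra.antipode (R := k) h * x * S' h')) := by
  intro h a h' x
  rw [← mul_assoc _ _ (S' h'), hlam _ (S' h'), hS'₁, HopfAlgebra.antipode_mul_antidistrib,
    HopfAlgebra.antipode_mul_antidistrib]
  simp only [mul_assoc]
end

section
/- Let H be a finite-dimensional Hopf algebra over a field k. For each finite-dimensional left H-module X define the linear map ι_X : X*⊗X → H* by ι_X(ξ⊗x) = (h ↦ ξ(h·x)). Let Z be any k-vector space and let (j_X) be a family of linear maps j_X : X*⊗X → Z, indexed by the finite-dimensional left H-modules, that is dinatural: for every homomorphism of H-modules f : X → Y and all η ∈ Y*, x ∈ X one has j_Y(η ⊗ f(x)) = j_X((η∘f) ⊗ x). Then there exists a unique linear map κ : H* → Z with j_X = κ ∘ ι_X for all X; explicitly, κ(φ) = j_H(φ ⊗ 1), where H is regarded as the left regular module over itself. (Thus H*, together with the family ι, is the coend of the functor X × Y ↦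 X*⊗Y over the category of finite-dimensional left H-modules.) -/
open scoped TensorProduct

variable (k H : Type) [Field k] [Ring H] [HopfAlgebra k H]

/-- For a left `H`-module `X`, the `k`-linear map `x ↦ (h ↦ h • x)`. -/
noncomputable def actMapL (X : Type) [AddCommGroup X] [Module k X] [Module H X]
    [IsScalarTower k H X] : X →ₗ[k] (H →ₗ[k] X) where
  toFun x :=
    { toFun := fun h => h • x
      map_add' := fun a b => add_smul a b x
      map_smul' := fun c a => by
        simp only [RingHom.id_apply]
        exact smul_assoc c a x }
  map_add' x y := by ext h; exact smul_add h x y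
  map_smul' c x := by ext h; exact smul_comm h c x

/-- The dinatural family `ι_X : X* ⊗ X → H*`, `ι_X(ξ ⊗ x) = (h ↦ ξ (h • x))`. -/
noncomputable def iota (X : Type) [AddCommGroup X] [Module k X] [Module H X]
    [IsScalarTower k H X] : Module.Dual k X ⊗[k] X →ₗ[k] Module.Dual k H :=
  TensorProduct.lift (LinearMap.compl₂ (LinearMap.llcomp k H X k) (actMapL k H X))

/-- `H*`, together with the family `ι`, is the coend of
`(X, Y) ↦ X* ⊗ Y` over finite-dimensional left `H`-modules: every dinatural family `j` into a
vector space `Z` factors uniquely as `j_X = κ ∘ ι_X`, and necessarily `κ φ = j_H (φ ⊗ 1)`. -/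
theorem dual_is_coend [FiniteDimensional k H]
    (Z : Type) [AddCommGroup Z] [Module k Z]
    (j : ∀ (X : Type) [AddCommGroup X] [Module k X] [Module H X] [IsScalarTower k H X]
      [FiniteDimensional k X], Module.Dual k X ⊗[k] X →ₗ[k] Z)
    (hj : ∀ (X Y : Type) [AddCommGroup X] [Module k X] [Module H X] [IsScalarTower k H X]
      [FiniteDimensional k X] [AddCommGroup Y] [Module k Y] [Module H Y] [IsScalarTower k H Y]
      [FiniteDimensional k Y] (f : X →ₗ[H] Y) (η : Module.Dual k Y) (x : X),
      j Y (η ⊗ₜ[k] f x) = j X ((η ∘ₗ (f.restrictScalars k)) ⊗ₜ[k] x)) :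
    (∃! κ : Module.Dual k H →ₗ[k] Z,
      ∀ (X : Type) [AddCommGroup X] [Module k X] [Module H X] [IsScalarTower k H X]
        [FiniteDimensional k X], j X = κ ∘ₗ iota k H X) ∧
    (∀ κ : Module.Dual k H →ₗ[k] Z,
      (∀ (X : Type) [AddCommGroup X] [Module k X] [Module H X] [IsScalarTower k H X]
        [FiniteDimensional k X], j X = κ ∘ₗ iota k H X) →
      ∀ φ : Module.Dual k H, κ φ = j H (φ ⊗ₜ[k] (1 : H))) := by
  have iota_regular : ∀ φ : Module.Dual k H, iota k H H (φ ⊗ₜ[k] (1 : H)) = φ := by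
    intro φ
    ext h
    exact congrArg φ (mul_one h)
  have apply_eq : ∀ κ : Module.Dual k H →ₗ[k] Z,
      (∀ (X : Type) [AddCommGroup X] [Module k X] [Module H X] [IsScalarTower k H X]
        [FiniteDimensional k X], j X = κ ∘ₗ iota k H X) →
      ∀ φ : Module.Dual k H, κ φ = j H (φ ⊗ₜ[k] (1 : H)) := by
    intro κ hκ φ
    rw [hκ H, LinearMap.comp_apply, iota_regular]
  refine ⟨⟨j H ∘ₗ (TensorProduct.mk k (Module.Dual k H) H).flip 1, ?_, ?_⟩, apply_eq⟩
  · intro X _ _ _ _ _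
    refine TensorProduct.ext' fun ξ x => ?_
    have h := hj H X (LinearMap.toSpanSingleton H X x) ξ 1
    rw [LinearMap.toSpanSingleton_apply, one_smul] at h
    exact h
  · intro κ hκ
    ext φ
    exact apply_eq κ hκ φ
end

section
/- Let C be a monoidal category and A an object of C equipped with an associative unital algebra structure (m : A⊗A → A, η : 𝟙 → A). Suppose A has a right dual A^∨ with evaluation d_A : A^∨⊗A → 𝟙 and coevaluation b_A : 𝟙 → A⊗A^∨, and let κ : A⊗A → 𝟙 be an invariant pairing, i.e. κ∘(m⊗id_A) = κ∘(id_A⊗m). Then the morphism Φ := (κ⊗id_{A^∨}) ∘ (id_A⊗b_A) : A → A^∨ is an isomorphism if and only if there exist morphisms Δ : A → A⊗A and ε : A → 𝟙 such that (A, m, η, Δ, ε) is a Frobenius algebra with ε∘m = κ. (In words: an algebra with an invariant pairing is Frobenius if and only if the pairing is non-degenerate.) -/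
open CategoryTheory MonoidalCategory

universe v u

/-- A Frobenius algebra structure on an object `A` of a monoidal category: `(A, m, η)` is an
associative unital algebra, `(A, Δ, ε)` is a coassociative counital coalgebra, and the
Frobenius law holds. -/
structure IsFrobenius {C : Type u} [Category.{v} C] [MonoidalCategory C]
    (A : C) (m : A ⊗ A ⟶ A) (η : 𝟙_ C ⟶ A) (Δ : A ⟶ A ⊗ A) (ε : A ⟶ 𝟙_ C) : Prop where
  mul_assoc : (m ▷ A) ≫ m = (α_ A A A).hom ≫ (A ◁ m) ≫ m
  one_mul : (η ▷ A) ≫ m = (λ_ A).hom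
  mul_one : (A ◁ η) ≫ m = (ρ_ A).hom
  coassoc : Δ ≫ (Δ ▷ A) = Δ ≫ (A ◁ Δ) ≫ (α_ A A A).inv
  counit_left : Δ ≫ (ε ▷ A) = (λ_ A).inv
  counit_right : Δ ≫ (A ◁ ε) = (ρ_ A).inv
  frob_left : (Δ ▷ A) ≫ (α_ A A A).hom ≫ (A ◁ m) = m ≫ Δ
  frob_right : (A ◁ Δ) ≫ (α_ A A A).inv ≫ (m ▷ A) = m ≫ Δ

namespace FrobeniusPairing

variable {C : Type u} [Category.{v} C] [MonoidalCategory C] {A : C}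

/-- The comultiplication `a ↦ (a * γ₁) ⊗ γ₂` induced by a copairing `γ` on an algebra. -/
def comulOfCopairing (m : A ⊗ A ⟶ A) (γ : 𝟙_ C ⟶ A ⊗ A) : A ⟶ A ⊗ A :=
  (ρ_ A).inv ≫ A ◁ γ ≫ (α_ A A A).inv ≫ m ▷ A

/-- The functional `κ (1, -)` attached to a pairing `κ` on a unital algebra. -/
def counitOfPairing (η : 𝟙_ C ⟶ A) (κ : A ⊗ A ⟶ 𝟙_ C) : A ⟶ 𝟙_ C :=
  (λ_ A).inv ≫ η ▷ A ≫ κ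

/-- If `κ` is an invariant pairing with inverse copairing `γ`, then
`(a * γ₁) ⊗ γ₂ = γ₁ ⊗ (γ₂ * a)`. -/
theorem comulOfCopairing_eq {m : A ⊗ A ⟶ A} {κ : A ⊗ A ⟶ 𝟙_ C} {γ : 𝟙_ C ⟶ A ⊗ A}
    (hκ : m ▷ A ≫ κ = (α_ A A A).hom ≫ A ◁ m ≫ κ)
    (hl : A ◁ γ ≫ (α_ A A A).inv ≫ κ ▷ A = (ρ_ A).hom ≫ (λ_ A).inv)
    (hr : γ ▷ A ≫ (α_ A A A).hom ≫ A ◁ κ = (λ_ A).hom ≫ (ρ_ A).inv) :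
    comulOfCopairing m γ = (λ_ A).inv ≫ γ ▷ A ≫ (α_ A A A).hom ≫ A ◁ m := by
  have hκ' : A ◁ m ≫ κ = (α_ A A A).inv ≫ m ▷ A ≫ κ := by simp [hκ]
  calc
    _ = 𝟙 _ ⊗≫ A ◁ γ ⊗≫ m ▷ A ⊗≫ ((λ_ A).hom ≫ (ρ_ A).inv) ▷ A ⊗≫ 𝟙 _ := by
      rw [comulOfCopairing]; monoidal
    _ = 𝟙 _ ⊗≫ A ◁ γ ⊗≫ (𝟙_ C ◁ (m ▷ A) ≫ γ ▷ (A ⊗ A)) ⊗≫ A ◁ κ ▷ A ⊗≫ 𝟙 _ := by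
      rw [← hr]; monoidal
    _ = 𝟙 _ ⊗≫ (𝟙_ C ◁ (A ◁ γ) ≫ γ ▷ (A ⊗ A ⊗ A)) ⊗≫ A ◁ (A ◁ m ≫ κ) ▷ A ⊗≫ 𝟙 _ := by
      rw [whisker_exchange]; monoidal
    _ = 𝟙 _ ⊗≫ γ ▷ A ⊗≫ A ◁ ((A ⊗ A) ◁ γ ≫ m ▷ (A ⊗ A)) ⊗≫ A ◁ κ ▷ A ⊗≫ 𝟙 _ := by
      rw [whisker_exchange, hκ']; monoidal
    _ = 𝟙 _ ⊗≫ γ ▷ A ⊗≫ A ◁ m ⊗≫ A ◁ (A ◁ γ ≫ (α_ A A A).inv ≫ κ ▷ A) ⊗≫ 𝟙 _ := by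
      rw [whisker_exchange]; monoidal
    _ = _ := by
      rw [hl]; monoidal

theorem mul_counitOfPairing {m : A ⊗ A ⟶ A} {η : 𝟙_ C ⟶ A} {κ : A ⊗ A ⟶ 𝟙_ C}
    (honemul : η ▷ A ≫ m = (λ_ A).hom)
    (hκ : m ▷ A ≫ κ = (α_ A A A).hom ≫ A ◁ m ≫ κ) :
    m ≫ counitOfPairing η κ = κ := by
  have hκ' : A ◁ m ≫ κ = (α_ A A A).inv ≫ m ▷ A ≫ κ := by simp [hκ]
  calc
    _ = 𝟙 _ ⊗≫ (𝟙_ C ◁ m ≫ η ▷ A) ⊗≫ κ := by rw [counitOfPairing]; monoidal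
    _ = 𝟙 _ ⊗≫ η ▷ (A ⊗ A) ⊗≫ (A ◁ m ≫ κ) := by rw [whisker_exchange]; monoidal
    _ = 𝟙 _ ⊗≫ (η ▷ A ≫ m) ▷ A ⊗≫ κ := by rw [hκ']; monoidal
    _ = κ := by rw [honemul]; monoidal

/-- An algebra with an invariant pairing that has an inverse copairing is Frobenius. -/
theorem isFrobenius_of_copairing {m : A ⊗ A ⟶ A} {η : 𝟙_ C ⟶ A}
    {κ : A ⊗ A ⟶ 𝟙_ C} {γ : 𝟙_ C ⟶ A ⊗ A}
    (hassoc : m ▷ A ≫ m = (α_ A A A).hom ≫ A ◁ m ≫ m)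
    (honemul : η ▷ A ≫ m = (λ_ A).hom)
    (hmulone : A ◁ η ≫ m = (ρ_ A).hom)
    (hκ : m ▷ A ≫ κ = (α_ A A A).hom ≫ A ◁ m ≫ κ)
    (hl : A ◁ γ ≫ (α_ A A A).inv ≫ κ ▷ A = (ρ_ A).hom ≫ (λ_ A).inv)
    (hr : γ ▷ A ≫ (α_ A A A).hom ≫ A ◁ κ = (λ_ A).hom ≫ (ρ_ A).inv) :
    IsFrobenius A m η (comulOfCopairing m γ) (counitOfPairing η κ) := by
  have hΔ := comulOfCopairing_eq hκ hl hr
  have hε := mul_counitOfPairing honemul hκ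
  have hassoc' : A ◁ m ≫ m = (α_ A A A).inv ≫ m ▷ A ≫ m := by simp [hassoc]
  refine ⟨hassoc, honemul, hmulone, ?_, ?_, ?_, ?_, ?_⟩
  · calc
      _ = comulOfCopairing m γ ≫
            ((λ_ A).inv ≫ γ ▷ A ≫ (α_ A A A).hom ≫ A ◁ m) ▷ A := by rw [← hΔ]
      _ = 𝟙 _ ⊗≫ A ◁ γ ⊗≫ (𝟙_ C ◁ (m ▷ A) ≫ γ ▷ (A ⊗ A)) ⊗≫ A ◁ m ▷ A ⊗≫ 𝟙 _ := by
        rw [comulOfCopairing]; monoidal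
      _ = 𝟙 _ ⊗≫ (𝟙_ C ◁ (A ◁ γ) ≫ γ ▷ (A ⊗ A ⊗ A)) ⊗≫ A ◁ (A ◁ m ≫ m) ▷ A ⊗≫ 𝟙 _ := by
        rw [whisker_exchange]; monoidal
      _ = 𝟙 _ ⊗≫ γ ▷ A ⊗≫ A ◁ ((A ⊗ A) ◁ γ ≫ m ▷ (A ⊗ A)) ⊗≫ A ◁ m ▷ A ⊗≫ 𝟙 _ := by
        rw [whisker_exchange, hassoc']; monoidal
      _ = ((λ_ A).inv ≫ γ ▷ A ≫ (α_ A A A).hom ≫ A ◁ m) ≫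
            A ◁ comulOfCopairing m γ ≫ (α_ A A A).inv := by
        rw [whisker_exchange, comulOfCopairing]; monoidal
      _ = _ := by rw [← hΔ]
  · calc
      _ = (ρ_ A).inv ≫ A ◁ γ ≫ (α_ A A A).inv ≫ (m ≫ counitOfPairing η κ) ▷ A := by
        rw [comulOfCopairing]; monoidal
      _ = _ := by rw [hε, hl]; simp
  · calc
      _ = (λ_ A).inv ≫ γ ▷ A ≫ (α_ A A A).hom ≫ A ◁ (m ≫ counitOfPairing η κ) := by
        rw [hΔ]; monoidal
      _ = _ := by rw [hε, hr]; simp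
  · calc
      _ = 𝟙 _ ⊗≫ γ ▷ (A ⊗ A) ⊗≫ A ◁ (m ▷ A ≫ m) := by rw [hΔ]; monoidal
      _ = 𝟙 _ ⊗≫ (γ ▷ (A ⊗ A) ≫ (A ⊗ A) ◁ m) ⊗≫ A ◁ m := by rw [hassoc]; monoidal
      _ = _ := by rw [← whisker_exchange, hΔ]; monoidal
  · calc
      _ = 𝟙 _ ⊗≫ (A ⊗ A) ◁ γ ⊗≫ (A ◁ m ≫ m) ▷ A := by rw [comulOfCopairing]; monoidal
      _ = 𝟙 _ ⊗≫ ((A ⊗ A) ◁ γ ≫ m ▷ (A ⊗ A)) ⊗≫ m ▷ A := by rw [hassoc']; monoidal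
      _ = _ := by rw [whisker_exchange, comulOfCopairing]; monoidal

end FrobeniusPairing

namespace IsFrobenius

variable {C : Type u} [Category.{v} C] [MonoidalCategory C] {A : C}
  {m : A ⊗ A ⟶ A} {η : 𝟙_ C ⟶ A} {Δ : A ⟶ A ⊗ A} {ε : A ⟶ 𝟙_ C}

theorem unit_comul_zigzag_left (h : IsFrobenius A m η Δ ε) :
    A ◁ (η ≫ Δ) ≫ (α_ A A A).inv ≫ (m ≫ ε) ▷ A = (ρ_ A).hom ≫ (λ_ A).inv := by
  calc
    _ = A ◁ η ≫ (A ◁ Δ ≫ (α_ A A A).inv ≫ m ▷ A) ≫ ε ▷ A := by simp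
    _ = (A ◁ η ≫ m) ≫ Δ ≫ ε ▷ A := by rw [h.frob_right]; simp
    _ = _ := by rw [h.mul_one, h.counit_left]

theorem unit_comul_zigzag_right (h : IsFrobenius A m η Δ ε) :
    (η ≫ Δ) ▷ A ≫ (α_ A A A).hom ≫ A ◁ (m ≫ ε) = (λ_ A).hom ≫ (ρ_ A).inv := by
  calc
    _ = η ▷ A ≫ (Δ ▷ A ≫ (α_ A A A).hom ≫ A ◁ m) ≫ A ◁ ε := by simp
    _ = (η ▷ A ≫ m) ≫ Δ ≫ A ◁ ε := by rw [h.frob_left]; simp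
    _ = _ := by rw [h.one_mul, h.counit_right]

end IsFrobenius

namespace FrobeniusPairing

variable {C : Type u} [Category.{v} C] [MonoidalCategory C] {A Av : C}

/-- The map `A ⟶ Av` obtained from a pairing on `A` and a coevaluation `b`. -/
def toDual (b : 𝟙_ C ⟶ A ⊗ Av) (κ : A ⊗ A ⟶ 𝟙_ C) : A ⟶ Av :=
  (ρ_ A).inv ≫ A ◁ b ≫ (α_ A A Av).inv ≫ κ ▷ Av ≫ (λ_ Av).hom

theorem toDual_whiskerRight_comp {d : Av ⊗ A ⟶ 𝟙_ C} {b : 𝟙_ C ⟶ A ⊗ Av}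
    (hzig : (λ_ A).inv ≫ b ▷ A ≫ (α_ A Av A).hom ≫ A ◁ d ≫ (ρ_ A).hom = 𝟙 A)
    (κ : A ⊗ A ⟶ 𝟙_ C) : toDual b κ ▷ A ≫ d = κ := by
  calc
    _ = 𝟙 _ ⊗≫ A ◁ b ▷ A ⊗≫ (κ ▷ (Av ⊗ A) ≫ 𝟙_ C ◁ d) ⊗≫ 𝟙 _ := by
      rw [toDual]; monoidal
    _ = A ◁ ((λ_ A).inv ≫ b ▷ A ≫ (α_ A Av A).hom ≫ A ◁ d ≫ (ρ_ A).hom) ≫ κ := by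
      rw [← whisker_exchange]; monoidal
    _ = κ := by rw [hzig]; simp

/-- A pairing with an inverse copairing `γ` induces an isomorphism onto the right dual. -/
theorem isIso_toDual {d : Av ⊗ A ⟶ 𝟙_ C} {b : 𝟙_ C ⟶ A ⊗ Av}
    (hzig : (λ_ A).inv ≫ b ▷ A ≫ (α_ A Av A).hom ≫ A ◁ d ≫ (ρ_ A).hom = 𝟙 A)
    (hzag : (ρ_ Av).inv ≫ Av ◁ b ≫ (α_ Av A Av).inv ≫ d ▷ Av ≫ (λ_ Av).hom = 𝟙 Av)
    {κ : A ⊗ A ⟶ 𝟙_ C} {γ : 𝟙_ C ⟶ A ⊗ A}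
    (hl : A ◁ γ ≫ (α_ A A A).inv ≫ κ ▷ A = (ρ_ A).hom ≫ (λ_ A).inv)
    (hr : γ ▷ A ≫ (α_ A A A).hom ≫ A ◁ κ = (λ_ A).hom ≫ (ρ_ A).inv) :
    IsIso (toDual b κ) := by
  refine ⟨(ρ_ Av).inv ≫ Av ◁ γ ≫ (α_ Av A A).inv ≫ d ▷ A ≫ (λ_ A).hom, ?_, ?_⟩
  · calc
      _ = 𝟙 _ ⊗≫ (toDual b κ ▷ 𝟙_ C ≫ Av ◁ γ) ⊗≫ d ▷ A ⊗≫ 𝟙 _ := by monoidal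
      _ = 𝟙 _ ⊗≫ A ◁ γ ⊗≫ (toDual b κ ▷ A ≫ d) ▷ A ⊗≫ 𝟙 _ := by
        rw [← whisker_exchange]; monoidal
      _ = 𝟙 _ ⊗≫ (A ◁ γ ≫ (α_ A A A).inv ≫ κ ▷ A) ⊗≫ 𝟙 _ := by
        rw [toDual_whiskerRight_comp hzig]; monoidal
      _ = 𝟙 A := by rw [hl]; monoidal
  · calc
      _ = 𝟙 _ ⊗≫ Av ◁ γ ⊗≫ (d ▷ A ≫ 𝟙_ C ◁ toDual b κ) ⊗≫ 𝟙 _ := by monoidal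
      _ = 𝟙 _ ⊗≫ Av ◁ (γ ▷ 𝟙_ C ≫ (A ⊗ A) ◁ b) ⊗≫ Av ◁ A ◁ κ ▷ Av ⊗≫ d ▷ Av ⊗≫ 𝟙 _ := by
        rw [← whisker_exchange, toDual]; monoidal
      _ = 𝟙 _ ⊗≫ Av ◁ b ⊗≫ Av ◁ (γ ▷ A ≫ (α_ A A A).hom ≫ A ◁ κ) ▷ Av ⊗≫
            d ▷ Av ⊗≫ 𝟙 _ := by
        rw [← whisker_exchange]; monoidal
      _ = (ρ_ Av).inv ≫ Av ◁ b ≫ (α_ Av A Av).inv ≫ d ▷ Av ≫ (λ_ Av).hom := by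
        rw [hr]; monoidal
      _ = 𝟙 Av := hzag

/-- A pairing inducing an isomorphism onto the right dual has an inverse copairing. -/
theorem exists_copairing_of_isIso_toDual {d : Av ⊗ A ⟶ 𝟙_ C} {b : 𝟙_ C ⟶ A ⊗ Av}
    (hzig : (λ_ A).inv ≫ b ▷ A ≫ (α_ A Av A).hom ≫ A ◁ d ≫ (ρ_ A).hom = 𝟙 A)
    (κ : A ⊗ A ⟶ 𝟙_ C) [IsIso (toDual b κ)] :
    ∃ γ : 𝟙_ C ⟶ A ⊗ A,
      A ◁ γ ≫ (α_ A A A).inv ≫ κ ▷ A = (ρ_ A).hom ≫ (λ_ A).inv ∧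
      γ ▷ A ≫ (α_ A A A).hom ≫ A ◁ κ = (λ_ A).hom ≫ (ρ_ A).inv := by
  refine ⟨b ≫ A ◁ inv (toDual b κ), ?_, ?_⟩
  · calc
      _ = 𝟙 _ ⊗≫ A ◁ b ⊗≫ ((A ⊗ A) ◁ inv (toDual b κ) ≫ κ ▷ A) ⊗≫ 𝟙 _ := by monoidal
      _ = (ρ_ A).hom ≫ ((ρ_ A).inv ≫ A ◁ b ≫ (α_ A A Av).inv ≫ κ ▷ Av ≫ (λ_ Av).hom) ≫
            inv (toDual b κ) ≫ (λ_ A).inv := by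
        rw [whisker_exchange]; monoidal
      _ = _ := by rw [← toDual, IsIso.hom_inv_id_assoc]
  · calc
      _ = b ▷ A ≫ (α_ A Av A).hom ≫ A ◁ (inv (toDual b κ) ▷ A ≫ κ) := by monoidal
      _ = b ▷ A ≫ (α_ A Av A).hom ≫ A ◁ d := by
        nth_rw 2 [← toDual_whiskerRight_comp hzig κ]
        rw [inv_hom_whiskerRight'_assoc]
      _ = (λ_ A).hom ≫ ((λ_ A).inv ≫ b ▷ A ≫ (α_ A Av A).hom ≫ A ◁ d ≫ (ρ_ A).hom) ≫
            (ρ_ A).inv := by simp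
      _ = _ := by rw [hzig, Category.id_comp]

end FrobeniusPairing

/-- Let `A` be an algebra in a monoidal category with a right dual `Av`
(evaluation `d`, coevaluation `b` satisfying the zig-zag identities) and an invariant pairing
`κ`.  Then `Φ = (κ ⊗ id) ∘ (id ⊗ b) : A ⟶ Av` is an isomorphism if and only if `(A, m, η)`
extends to a Frobenius algebra `(A, m, η, Δ, ε)` with `ε ∘ m = κ`. -/
theorem frobenius_iff_nondegenerate_pairing
    {C : Type u} [Category.{v} C] [MonoidalCategory C]
    (A Av : C) (m : A ⊗ A ⟶ A) (η : 𝟙_ C ⟶ A)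
    (hassoc : (m ▷ A) ≫ m = (α_ A A A).hom ≫ (A ◁ m) ≫ m)
    (honemul : (η ▷ A) ≫ m = (λ_ A).hom)
    (hmulone : (A ◁ η) ≫ m = (ρ_ A).hom)
    (d : Av ⊗ A ⟶ 𝟙_ C) (b : 𝟙_ C ⟶ A ⊗ Av)
    (hzig : (λ_ A).inv ≫ (b ▷ A) ≫ (α_ A Av A).hom ≫ (A ◁ d) ≫ (ρ_ A).hom = 𝟙 A)
    (hzag : (ρ_ Av).inv ≫ (Av ◁ b) ≫ (α_ Av A Av).inv ≫ (d ▷ Av) ≫ (λ_ Av).hom = 𝟙 Av)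
    (κ : A ⊗ A ⟶ 𝟙_ C)
    (hκ : (m ▷ A) ≫ κ = (α_ A A A).hom ≫ (A ◁ m) ≫ κ) :
    IsIso ((ρ_ A).inv ≫ (A ◁ b) ≫ (α_ A A Av).inv ≫ (κ ▷ Av) ≫ (λ_ Av).hom) ↔
      ∃ (Δ : A ⟶ A ⊗ A) (ε : A ⟶ 𝟙_ C), IsFrobenius A m η Δ ε ∧ m ≫ ε = κ := by
  change IsIso (FrobeniusPairing.toDual b κ) ↔ _
  constructor
  · intro _
    obtain ⟨γ, hl, hr⟩ := FrobeniusPairing.exists_copairing_of_isIso_toDual hzig κ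
    exact ⟨_, _, FrobeniusPairing.isFrobenius_of_copairing hassoc honemul hmulone hκ hl hr,
      FrobeniusPairing.mul_counitOfPairing honemul hκ⟩
  · rintro ⟨Δ, ε, h, rfl⟩
    exact FrobeniusPairing.isIso_toDual hzig hzag h.unit_comul_zigzag_left
      h.unit_comul_zigzag_right
end
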